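/- For N ≥ 2 and any N×N complex matrices A, B, C, D, the average over the unitary group U(N) with respect to normalized Haar measure satisfies ⟨Tr(U*AUBUᵗCŪD)⟩ = (1/(N²−1))·[Tr(A)Tr(C)Tr(BD) + Tr(ACᵗ)Tr(BDᵗ)] − (1/(N(N²−1)))·[Tr(ACᵗ)Tr(BD) + Tr(A)Tr(C)Tr(BDᵗ)]. -/

import Mathlib

open MeasureTheory Matrix

noncomputable instance (m n α : Type*) [MeasurableSpace α] : MeasurableSpace (Matrix m n α) :=
  (inferInstance : MeasurableSpace (m → n → α))

section InvariantTensor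

variable {n : Type*} [Fintype n] [DecidableEq n]

/-- A tensor fixed by the action of every unitary matrix, conjugate on the outer two indices. -/
def IsUnitaryInvariant (T : n → n → n → n → ℂ) : Prop :=
  ∀ S ∈ unitaryGroup n ℂ, ∀ i j k l, T i j k l =
    ∑ i', star (S i i') * ∑ j', S j j' * ∑ k', S k k' * ∑ l', star (S l l') * T i' j' k' l'

theorem diagonal_mem_unitaryGroup {d : n → ℂ} (hd : ∀ i, d i * star (d i) = 1) :
    diagonal d ∈ unitaryGroup n ℂ := by
  rw [mem_unitaryGroup_iff, star_eq_conjTranspose, diagonal_conjTranspose, diagonal_mul_diagonal,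
    ← diagonal_one]
  congr 1
  funext i
  exact hd i

theorem submatrix_one_mem_unitaryGroup (σ : Equiv.Perm n) :
    (1 : Matrix n n ℂ).submatrix σ id ∈ unitaryGroup n ℂ := by
  rw [mem_unitaryGroup_iff, star_eq_conjTranspose, conjTranspose_submatrix, conjTranspose_one]
  change (1 : Matrix n n ℂ).submatrix σ (Equiv.refl n) *
    (1 : Matrix n n ℂ).submatrix (Equiv.refl n) σ = 1
  rw [submatrix_mul_equiv]
  simp

/-- A square root of the permutation matrix of a transposition. -/
noncomputable def sqrtSwap (p q : n) : Matrix n n ℂ :=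
  ((1 + Complex.I) / 2) • (1 : Matrix n n ℂ) +
    ((1 - Complex.I) / 2) • (1 : Matrix n n ℂ).submatrix (Equiv.swap p q) id

theorem sqrtSwap_mem_unitaryGroup (p q : n) : sqrtSwap p q ∈ unitaryGroup n ℂ := by
  set P := (1 : Matrix n n ℂ).submatrix (Equiv.swap p q) id with hP
  have hstar : star P = P := by
    ext i j
    simp only [hP, star_apply, submatrix_apply, one_apply, id]
    by_cases h : Equiv.swap p q i = j
    · have : Equiv.swap p q j = i := by rw [← h, Equiv.swap_apply_self]
      simp [h, this]
    · have : Equiv.swap p q j ≠ i := fun h' => h (by rw [← h', Equiv.swap_apply_self])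
      simp [h, this]
  have hsq : P * P = 1 := by
    have := mem_unitaryGroup_iff.1 (submatrix_one_mem_unitaryGroup (Equiv.swap p q))
    rwa [← hP, hstar] at this
  rw [mem_unitaryGroup_iff, sqrtSwap, ← hP, star_add, star_smul, star_smul, hstar, star_one]
  simp only [add_mul, mul_add, smul_mul_smul_comm, hsq, mul_one, one_mul]
  ext i j
  simp only [Matrix.add_apply, Matrix.smul_apply, smul_eq_mul, Complex.star_def, map_div₀, map_add, map_sub,
    map_one, map_ofNat, Complex.conj_I]
  linear_combination (-(1 / 2) * (1 : Matrix n n ℂ) i j + 1 / 2 * P i j) * Complex.I_sq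

theorem sum_sqrtSwap_mul (p q : n) (f : n → ℂ) :
    ∑ x, sqrtSwap p q p x * f x =
      ((1 + Complex.I) / 2) * f p + ((1 - Complex.I) / 2) * f q := by
  simp [sqrtSwap, one_apply, add_mul, Finset.sum_add_distrib]

theorem sum_star_sqrtSwap_mul (p q : n) (f : n → ℂ) :
    ∑ x, star (sqrtSwap p q p x) * f x =
      ((1 - Complex.I) / 2) * f p + ((1 + Complex.I) / 2) * f q := by
  simp [sqrtSwap, one_apply, add_mul, Finset.sum_add_distrib, apply_ite (starRingEnd ℂ), Complex.conj_ofNat]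
  exact Or.inl (by ring)

namespace IsUnitaryInvariant

variable {T : n → n → n → n → ℂ}

theorem eq_diagonal (hT : IsUnitaryInvariant T) {d : n → ℂ} (hd : ∀ i, d i * star (d i) = 1)
    (i j k l : n) : T i j k l = star (d i) * (d j * (d k * (star (d l) * T i j k l))) := by
  have h := hT _ (diagonal_mem_unitaryGroup hd) i j k l
  simpa [diagonal_apply, apply_ite] using h

theorem eq_perm (hT : IsUnitaryInvariant T) (σ : Equiv.Perm n) (i j k l : n) :
    T i j k l = T (σ i) (σ j) (σ k) (σ l) := by
  have h := hT _ (submatrix_one_mem_unitaryGroup σ) i j k l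
  simpa [one_apply, apply_ite] using h

theorem eq_phase (hT : IsUnitaryInvariant T) (p i j k l : n) :
    T i j k l = star (if i = p then Complex.I else 1) * ((if j = p then Complex.I else 1) *
      ((if k = p then Complex.I else 1) * (star (if l = p then Complex.I else 1) *
        T i j k l))) := by
  refine hT.eq_diagonal (d := fun x => if x = p then Complex.I else 1) (fun x => ?_) i j k l
  split_ifs <;> simp

theorem eq_zero (hT : IsUnitaryInvariant T) {i j k l : n} (h₁ : ¬(i = j ∧ k = l))
    (h₂ : ¬(i = k ∧ j = l)) : T i j k l = 0 := by
  have hI : ∀ {z : ℂ}, z = Complex.I * z → z = 0 := fun {z} h => by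
    linear_combination (1 + Complex.I) / 2 * h + z / 2 * Complex.I_sq
  have hI' : ∀ {z : ℂ}, z = -(Complex.I * z) → z = 0 := fun {z} h => by
    linear_combination (1 - Complex.I) / 2 * h + z / 2 * Complex.I_sq
  have hneg : ∀ {z : ℂ}, z = Complex.I * (Complex.I * z) → z = 0 := fun {z} h => by
    linear_combination 1 / 2 * h + z / 2 * Complex.I_sq
  by_cases hij : i = j
  · subst hij
    have hkl : k ≠ l := fun h => h₁ ⟨rfl, h⟩
    have h := hT.eq_phase k i i k l
    rw [if_neg hkl.symm] at h
    by_cases hik : i = k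
    · subst hik
      apply hI
      simpa [← mul_assoc] using h
    · exact hI (by simpa [hik] using h)
  by_cases hik : i = k
  · subst hik
    have hjl : j ≠ l := fun h => h₂ ⟨rfl, h⟩
    have h := hT.eq_phase j i j i l
    exact hI (by simpa [hij, hjl.symm] using h)
  have h := hT.eq_phase i i j k l
  by_cases hil : l = i
  · exact hneg (by simpa [Ne.symm hij, Ne.symm hik, hil] using h)
  · exact hI' (by simpa [Ne.symm hij, Ne.symm hik, hil] using h)

theorem apply_self (hT : IsUnitaryInvariant T) {i k : n} (h : i ≠ k) :
    T i i i i = T i i k k + T i k i k := by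
  have hS := hT _ (sqrtSwap_mem_unitaryGroup i k) i i i i
  simp only [sum_sqrtSwap_mul, sum_star_sqrtSwap_mul] at hS
  have e₁ : T k k k k = T i i i i := by simpa using (hT.eq_perm (Equiv.swap i k) k k k k)
  have e₂ : T k k i i = T i i k k := by simpa using (hT.eq_perm (Equiv.swap i k) k k i i)
  have e₃ : T k i k i = T i k i k := by simpa using (hT.eq_perm (Equiv.swap i k) k i k i)
  have z₁ : T i i i k = 0 := hT.eq_zero (by simp [h]) (by simp [h])
  have z₂ : T i i k i = 0 := hT.eq_zero (by simp [h.symm]) (by simp [h])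
  have z₃ : T i k i i = 0 := hT.eq_zero (by simp [h]) (by simp [h.symm])
  have z₄ : T k i i i = 0 := hT.eq_zero (by simp [h.symm]) (by simp [h.symm])
  have z₅ : T i k k i = 0 := hT.eq_zero (by simp [h]) (by simp [h])
  have z₆ : T k i i k = 0 := hT.eq_zero (by simp [h.symm]) (by simp [h.symm])
  have z₇ : T i k k k = 0 := hT.eq_zero (by simp [h]) (by simp [h])
  have z₈ : T k i k k = 0 := hT.eq_zero (by simp [h.symm]) (by simp [h])
  have z₉ : T k k i k = 0 := hT.eq_zero (by simp [h]) (by simp [h.symm])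
  have z₀ : T k k k i = 0 := hT.eq_zero (by simp [h.symm]) (by simp [h.symm])
  simp only [e₁, e₂, e₃, z₁, z₂, z₃, z₄, z₅, z₆, z₇, z₈, z₉, z₀] at hS
  have hc : (1 + Complex.I) / 2 * ((1 - Complex.I) / 2) = 1 / 2 := by
    linear_combination -(1 / 4) * Complex.I_sq
  generalize (1 + Complex.I) / 2 = c at hS hc
  generalize (1 - Complex.I) / 2 = s at hS hc
  linear_combination 2 * hS +
    (2 * T i i i i + 2 * T i i k k + 2 * T i k i k) * 2 * (c * s + 1 / 2) * hc

theorem exists_eq [Nontrivial n] (hT : IsUnitaryInvariant T) : ∃ α β : ℂ, ∀ i j k l,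
    T i j k l = (if i = j ∧ k = l then α else 0) + (if i = k ∧ j = l then β else 0) := by
  obtain ⟨p, q, hpq⟩ := exists_pair_ne n
  have hσ : ∀ i k : n, i ≠ k → ∃ σ : Equiv.Perm n, σ i = p ∧ σ k = q := fun i k hik => by
    refine ⟨(Equiv.swap i p).trans (Equiv.swap (Equiv.swap i p k) q), ?_, by simp⟩
    rw [Equiv.trans_apply, Equiv.swap_apply_left]
    refine Equiv.swap_apply_of_ne_of_ne (fun h => hik ?_) hpq
    apply (Equiv.swap i p).injective
    rw [← h, Equiv.swap_apply_left]
  refine ⟨T p p q q, T p q p q, fun i j k l => ?_⟩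
  by_cases h₁ : i = j ∧ k = l <;> by_cases h₂ : i = k ∧ j = l
  · obtain ⟨rfl, rfl⟩ := h₁
    obtain ⟨rfl, -⟩ := h₂
    have e := hT.eq_perm (Equiv.swap i p) i i i i
    rw [Equiv.swap_apply_left] at e
    simp [e, hT.apply_self hpq]
  · obtain ⟨rfl, rfl⟩ := h₁
    have hik : i ≠ k := fun h => h₂ ⟨h, h⟩
    obtain ⟨σ, h, h'⟩ := hσ i k hik
    rw [hT.eq_perm σ, h, h']
    simp [hik]
  · obtain ⟨rfl, rfl⟩ := h₂
    have hij : i ≠ j := fun h => h₁ ⟨h, h⟩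
    obtain ⟨σ, h, h'⟩ := hσ i j hij
    rw [hT.eq_perm σ, h, h']
    simp [hij]
  · simp [h₁, h₂, hT.eq_zero h₁ h₂]

/-- An invariant tensor is determined by its two contractions. -/
theorem eq_of_contractions [Nontrivial n] (hT : IsUnitaryInvariant T) {x y : ℂ}
    (hx : ∑ i, ∑ k, T i i k k = x) (hy : ∑ i, ∑ j, T i j i j = y) (i j k l : n) :
    T i j k l =
      (if i = j ∧ k = l then (Fintype.card n * x - y) /
        (Fintype.card n * ((Fintype.card n : ℂ) ^ 2 - 1)) else 0) +
      (if i = k ∧ j = l then (Fintype.card n * y - x) /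
        (Fintype.card n * ((Fintype.card n : ℂ) ^ 2 - 1)) else 0) := by
  obtain ⟨α, β, h⟩ := hT.exists_eq
  have hN : (1 : ℝ) < Fintype.card n := by exact_mod_cast Fintype.one_lt_card
  have h0 : (Fintype.card n : ℂ) ≠ 0 := by exact_mod_cast (by linarith : (Fintype.card n : ℝ) ≠ 0)
  have h1 : (Fintype.card n : ℂ) ^ 2 - 1 ≠ 0 := by
    exact_mod_cast (by nlinarith : (Fintype.card n : ℝ) ^ 2 - 1 ≠ 0)
  simp only [h, and_self, Finset.sum_add_distrib, if_true, Finset.sum_const, Finset.card_univ,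
    Finset.sum_ite_eq, Finset.mem_univ, nsmul_eq_mul] at hx hy
  rw [h]
  congr 2
  · field_simp
    rw [← hx, ← hy]
    ring
  · field_simp
    rw [← hx, ← hy]
    ring

end IsUnitaryInvariant

end InvariantTensor

theorem integral_sum_sum_sum_sum {n X : Type*} [Fintype n] [MeasurableSpace X] {μ : Measure X}
    {f : n → n → n → n → X → ℂ} (hf : ∀ i j k l, Integrable (f i j k l) μ) :
    ∫ x, ∑ i, ∑ j, ∑ k, ∑ l, f i j k l x ∂μ = ∑ i, ∑ j, ∑ k, ∑ l, ∫ x, f i j k l x ∂μ := by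
  rw [integral_finsetSum _ fun i _ => integrable_finsetSum _ fun j _ =>
    integrable_finsetSum _ fun k _ => integrable_finsetSum _ fun l _ => hf i j k l]
  refine Finset.sum_congr rfl fun i _ => ?_
  rw [integral_finsetSum _ fun j _ =>
    integrable_finsetSum _ fun k _ => integrable_finsetSum _ fun l _ => hf i j k l]
  refine Finset.sum_congr rfl fun j _ => ?_
  rw [integral_finsetSum _ fun k _ => integrable_finsetSum _ fun l _ => hf i j k l]
  refine Finset.sum_congr rfl fun k _ => ?_
  rw [integral_finsetSum _ fun l _ => hf i j k l]

section MixedMoment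

variable {n : Type*}

/-- The mixed fourth moment of the entries of a random matrix. -/
noncomputable def mixedMoment (μ : Measure (Matrix n n ℂ)) (a b c d i j k l : n) : ℂ :=
  ∫ U, star (U i a) * U j b * U k c * star (U l d) ∂μ

theorem measurable_matrix_entry (i j : n) : Measurable fun U : Matrix n n ℂ => U i j :=
  (measurable_pi_apply j).comp (measurable_pi_apply (X := fun _ : n => n → ℂ) i)

theorem measurable_matrix_mul_left [Fintype n] (S : Matrix n n ℂ) :
    Measurable fun U : Matrix n n ℂ => S * U := by
  refine measurable_pi_iff.2 fun i => measurable_pi_iff.2 fun j => ?_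
  simp only [mul_apply]
  exact Finset.measurable_sum _ fun k _ => (measurable_matrix_entry k j).const_mul _

theorem measurable_mixed_entries (a b c d i j k l : n) : Measurable fun U : Matrix n n ℂ =>
    star (U i a) * U j b * U k c * star (U l d) := by
  have hs : ∀ i j : n, Measurable fun U : Matrix n n ℂ => star (U i j) := fun i j =>
    continuous_star.measurable.comp (measurable_matrix_entry i j)
  exact (((hs i a).mul (measurable_matrix_entry j b)).mul (measurable_matrix_entry k c)).mul
    (hs l d)

variable [Fintype n] [DecidableEq n] {μ : Measure (Matrix n n ℂ)} [IsProbabilityMeasure μ]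

theorem integrable_mixed_entries (hmem : ∀ᵐ U ∂μ, U ∈ unitaryGroup n ℂ)
    (a b c d i j k l : n) :
    Integrable (fun U : Matrix n n ℂ => star (U i a) * U j b * U k c * star (U l d)) μ := by
  refine Integrable.of_bound (measurable_mixed_entries a b c d i j k l).aestronglyMeasurable 1 ?_
  filter_upwards [hmem] with U hU
  have h := entry_norm_bound_of_unitary hU
  simp only [norm_mul, norm_star]
  have h₁ := mul_le_one₀ (h i a) (norm_nonneg _) (h j b)
  have h₂ := mul_le_one₀ h₁ (norm_nonneg _) (h k c)
  exact mul_le_one₀ h₂ (norm_nonneg _) (h l d)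

theorem isUnitaryInvariant_mixedMoment (hmem : ∀ᵐ U ∂μ, U ∈ unitaryGroup n ℂ)
    (hinv : ∀ S ∈ unitaryGroup n ℂ, μ.map (fun U => S * U) = μ) (a b c d : n) :
    IsUnitaryInvariant (mixedMoment μ a b c d) := by
  intro S hS i j k l
  have hint := integrable_mixed_entries hmem a b c d
  conv_lhs => rw [mixedMoment, ← hinv S hS]
  rw [integral_map (measurable_matrix_mul_left S).aemeasurable
    (measurable_mixed_entries a b c d i j k l).aestronglyMeasurable]
  have hexp : ∀ U : Matrix n n ℂ,
      star ((S * U) i a) * (S * U) j b * (S * U) k c * star ((S * U) l d) =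
        ∑ i', ∑ j', ∑ k', ∑ l', star (S i i') * (S j j' * (S k k' * (star (S l l') *
          (star (U i' a) * U j' b * U k' c * star (U l' d))))) := by
    intro U
    simp only [mul_apply, star_sum, star_mul']
    rw [Finset.sum_mul_sum, Finset.sum_mul, Finset.sum_mul]
    refine Finset.sum_congr rfl fun i' _ => ?_
    rw [Finset.sum_mul, Finset.sum_mul]
    refine Finset.sum_congr rfl fun j' _ => ?_
    rw [mul_assoc, Finset.sum_mul_sum, Finset.mul_sum]
    refine Finset.sum_congr rfl fun k' _ => ?_
    rw [Finset.mul_sum]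
    refine Finset.sum_congr rfl fun l' _ => ?_
    ring
  simp only [hexp, mixedMoment, Finset.mul_sum, ← integral_const_mul]
  exact integral_sum_sum_sum_sum fun i' j' k' l' =>
    ((((hint i' j' k' l').const_mul _).const_mul _).const_mul _).const_mul _

theorem mixedMoment_eq [Nontrivial n] (hmem : ∀ᵐ U ∂μ, U ∈ unitaryGroup n ℂ)
    (hinv : ∀ S ∈ unitaryGroup n ℂ, μ.map (fun U => S * U) = μ) (a b c d i j k l : n) :
    mixedMoment μ a b c d i j k l =
      (if i = j ∧ k = l then (Fintype.card n * (if a = b ∧ d = c then 1 else 0) -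
        (if a = c ∧ d = b then 1 else 0)) /
        (Fintype.card n * ((Fintype.card n : ℂ) ^ 2 - 1)) else 0) +
      (if i = k ∧ j = l then (Fintype.card n * (if a = c ∧ d = b then 1 else 0) -
        (if a = b ∧ d = c then 1 else 0)) /
        (Fintype.card n * ((Fintype.card n : ℂ) ^ 2 - 1)) else 0) := by
  have hint := integrable_mixed_entries hmem a b c d
  have horth : ∀ {U : Matrix n n ℂ}, U ∈ unitaryGroup n ℂ → ∀ a b,
      ∑ i, star (U i a) * U i b = if a = b then 1 else 0 := fun hU a b => by
    simpa [mul_apply, one_apply] using congrFun₂ (mem_unitaryGroup_iff'.1 hU) a b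
  have hprod : ∀ {U : Matrix n n ℂ}, U ∈ unitaryGroup n ℂ → ∀ a b c d,
      ∑ i, ∑ j, (star (U i a) * U i b) * (star (U j d) * U j c) =
        if a = b ∧ d = c then 1 else 0 := fun hU a b c d => by
    rw [← Finset.sum_mul_sum, horth hU, horth hU, ite_and, ite_mul, one_mul, zero_mul]
  apply (isUnitaryInvariant_mixedMoment hmem hinv a b c d).eq_of_contractions
  · simp only [mixedMoment]
    simp_rw [← integral_finsetSum Finset.univ fun k _ => hint _ _ k k]
    rw [← integral_finsetSum Finset.univ fun i _ => integrable_finsetSum _ fun k _ => hint i i k k]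
    trans ∫ _, (if a = b ∧ d = c then (1 : ℂ) else 0) ∂μ
    · refine integral_congr_ae ?_
      filter_upwards [hmem] with U hU
      rw [← hprod hU]
      refine Finset.sum_congr rfl fun i _ => Finset.sum_congr rfl fun k _ => ?_
      ring
    · simp
  · simp only [mixedMoment]
    simp_rw [← integral_finsetSum Finset.univ fun j _ => hint _ j _ j]
    rw [← integral_finsetSum Finset.univ fun i _ => integrable_finsetSum _ fun j _ => hint i j i j]
    trans ∫ _, (if a = c ∧ d = b then (1 : ℂ) else 0) ∂μ
    · refine integral_congr_ae ?_
      filter_upwards [hmem] with U hU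
      rw [← hprod hU]
      refine Finset.sum_congr rfl fun i _ => Finset.sum_congr rfl fun j _ => ?_
      ring
    · simp

end MixedMoment

theorem trace_mixed_eq_sum {n : Type*} [Fintype n] (A B C D U : Matrix n n ℂ) :
    (Uᴴ * A * U * B * Uᵀ * C * Uᴴᵀ * D).trace =
      ∑ a, ∑ d, ∑ c, ∑ b, ∑ j, ∑ i, ∑ l, ∑ k, (B b c * D d a * (A i j * C k l)) *
        (star (U i a) * U j b * U k c * star (U l d)) := by
  have hassoc : Uᴴ * A * U * B * Uᵀ * C * Uᴴᵀ * D = Uᴴ * A * U * B * (Uᵀ * C * Uᴴᵀ) * D := by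
    simp only [Matrix.mul_assoc]
  rw [hassoc, trace]
  refine Finset.sum_congr rfl fun a _ => ?_
  rw [diag_apply, mul_apply]
  refine Finset.sum_congr rfl fun d _ => ?_
  rw [mul_apply, Finset.sum_mul]
  refine Finset.sum_congr rfl fun c _ => ?_
  rw [mul_apply, Finset.sum_mul, Finset.sum_mul]
  refine Finset.sum_congr rfl fun b _ => ?_
  rw [mul_apply (M := Uᴴ * A), mul_assoc, mul_assoc, Finset.sum_mul]
  refine Finset.sum_congr rfl fun j _ => ?_
  rw [mul_apply, Finset.sum_mul, Finset.sum_mul]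
  refine Finset.sum_congr rfl fun i _ => ?_
  rw [mul_apply (M := Uᵀ * C), Finset.sum_mul, Finset.mul_sum, Finset.mul_sum]
  refine Finset.sum_congr rfl fun l _ => ?_
  rw [mul_apply, Finset.sum_mul, Finset.sum_mul, Finset.mul_sum, Finset.mul_sum]
  refine Finset.sum_congr rfl fun k _ => ?_
  simp only [conjTranspose_apply, transpose_apply]
  ring

theorem sum_mul_delta_add_delta {n : Type*} [Fintype n] [DecidableEq n] (A C : Matrix n n ℂ)
    (r p q : ℂ) :
    ∑ j, ∑ i, ∑ l, ∑ k, r * (A i j * C k l) *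
        ((if i = j ∧ k = l then p else 0) + (if i = k ∧ j = l then q else 0)) =
      r * (p * (A.trace * C.trace) + q * (A * Cᵀ).trace) := by
  simp only [mul_add, Finset.sum_add_distrib]
  congr 1
  · simp only [trace, diag_apply]
    rw [Finset.sum_mul_sum]
    simp only [ite_and, mul_ite, mul_zero, Finset.sum_ite_eq', Finset.mem_univ, if_true,
      Finset.sum_ite_irrel, Finset.sum_const_zero, Finset.mul_sum]
    refine Finset.sum_congr rfl fun i _ => Finset.sum_congr rfl fun k _ => ?_
    ring
  · rw [Finset.sum_comm]
    simp [ite_and, trace, mul_apply, Finset.mul_sum]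
    refine Finset.sum_congr rfl fun i _ => Finset.sum_congr rfl fun k _ => ?_
    ring

/-- For `N ≥ 2` and any `N×N` complex matrices `A, B, C, D`, the average over `U(N)` with
respect to normalized Haar measure satisfies
`⟨Tr(U*AUBUᵗCŪD)⟩ = (1/(N²−1))·[Tr(A)Tr(C)Tr(BD) + Tr(ACᵗ)Tr(BDᵗ)]
  − (1/(N(N²−1)))·[Tr(ACᵗ)Tr(BD) + Tr(A)Tr(C)Tr(BDᵗ)]`.
Here `Ū = Uᴴᵀ` is the entrywise complex conjugate. -/
theorem unitary_fourth_moment_mixed (N : ℕ) (hN : 2 ≤ N) (A B C D : Matrix (Fin N) (Fin N) ℂ)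
    (μ : Measure (Matrix (Fin N) (Fin N) ℂ)) [IsProbabilityMeasure μ]
    (hmem : ∀ᵐ U ∂μ, U ∈ Matrix.unitaryGroup (Fin N) ℂ)
    (hinv : ∀ S ∈ Matrix.unitaryGroup (Fin N) ℂ, μ.map (fun U => S * U) = μ) :
    ∫ U, (Uᴴ * A * U * B * Uᵀ * C * Uᴴᵀ * D).trace ∂μ =
      (1 / ((N : ℂ) ^ 2 - 1)) *
        (A.trace * C.trace * (B * D).trace + (A * Cᵀ).trace * (B * Dᵀ).trace) -
      (1 / ((N : ℂ) * ((N : ℂ) ^ 2 - 1))) *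
        ((A * Cᵀ).trace * (B * D).trace + A.trace * C.trace * (B * Dᵀ).trace) := by
  have : Nontrivial (Fin N) := Fin.nontrivial_iff_two_le.2 hN
  have hint := integrable_mixed_entries hmem
  simp only [trace_mixed_eq_sum]
  rw [integral_sum_sum_sum_sum fun a d c b => integrable_finsetSum _ fun j _ =>
    integrable_finsetSum _ fun i _ => integrable_finsetSum _ fun l _ =>
    integrable_finsetSum _ fun k _ => (hint a b c d i j k l).const_mul _]
  have hinner : ∀ a d c b, ∫ U, ∑ j, ∑ i, ∑ l, ∑ k, (B b c * D d a * (A i j * C k l)) *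
      (star (U i a) * U j b * U k c * star (U l d)) ∂μ =
        ∑ j, ∑ i, ∑ l, ∑ k, (B b c * D d a * (A i j * C k l)) *
          mixedMoment μ a b c d i j k l := fun a d c b => by
    rw [integral_sum_sum_sum_sum fun j i l k => (hint a b c d i j k l).const_mul _]
    simp only [integral_const_mul, mixedMoment]
  simp only [hinner, mixedMoment_eq hmem hinv, sum_mul_delta_add_delta, Fintype.card_fin]
  have h₁ : ∑ a, ∑ d, ∑ c, ∑ b, B b c * D d a * (if a = b ∧ d = c then 1 else 0) =
      (B * D).trace := by
    simp [ite_and, trace, mul_apply]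
  have h₂ : ∑ a, ∑ d, ∑ c, ∑ b, B b c * D d a * (if a = c ∧ d = b then 1 else 0) =
      (B * Dᵀ).trace := by
    simp [ite_and, trace, mul_apply]
    exact Finset.sum_comm
  have hN' : (2 : ℝ) ≤ N := by exact_mod_cast hN
  have h0 : (N : ℂ) ≠ 0 := by exact_mod_cast (by linarith : (N : ℝ) ≠ 0)
  have h1 : (N : ℂ) ^ 2 - 1 ≠ 0 := by exact_mod_cast (by nlinarith : (N : ℝ) ^ 2 - 1 ≠ 0)
  have hterm : ∀ r x y X Y : ℂ,
      r * ((N * x - y) / (N * ((N : ℂ) ^ 2 - 1)) * X +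
        (N * y - x) / (N * ((N : ℂ) ^ 2 - 1)) * Y) =
      (N * X - Y) / (N * ((N : ℂ) ^ 2 - 1)) * (r * x) +
        (N * Y - X) / (N * ((N : ℂ) ^ 2 - 1)) * (r * y) := fun r x y X Y => by ring
  simp only [hterm, Finset.sum_add_distrib, ← Finset.mul_sum, h₁, h₂]
  field_simp
  ring
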